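/- Let R be a regular local ring with maximal ideal I ≠ 0. Then the function v : R \ {0} → ℕ defined by v(g) = max{r ∈ ℕ | g ∈ I^r} satisfies v(g g') = v(g) + v(g') for all nonzero g, g', and extends to a discrete valuation on the fraction field of R. -/

import Mathlib

/-- The order function of a Noetherian local ring: `v g = max {r | g ∈ I^r}`
(computed as a supremum, which is attained for `g ≠ 0` by Krull's intersection theorem). -/
noncomputable def ordFun (R : Type*) [CommRing R] [IsLocalRing R] (g : R) : ℕ :=
  sSup {r : ℕ | g ∈ IsLocalRing.maximalIdeal R ^ r}

open IsLocalRing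

/-- The list `l` is a regular system of parameters: it generates the maximal ideal and its length
is the Krull dimension. -/
structure IsRegularSystem {R : Type*} [CommRing R] [IsLocalRing R] (l : List R) : Prop where
  maximalIdeal_eq : maximalIdeal R = Ideal.ofList l
  ringKrullDim_eq : ringKrullDim R = l.length

lemma Ideal.ofList_eq_of_perm {R : Type*} [CommRing R] {l l' : List R} (h : l.Perm l') :
    Ideal.ofList l = Ideal.ofList l' := by
  simp only [Ideal.ofList, h.mem_iff]

lemma Ideal.spanFinrank_ofList_le {R : Type*} [CommRing R] (l : List R) :
    (Ideal.ofList l).spanFinrank ≤ l.length := by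
  classical
  have hs : {r | r ∈ l} = (l.toFinset : Set R) := by ext; simp
  rw [Ideal.ofList, hs]
  refine (Submodule.spanFinrank_span_le_ncard_of_finite l.toFinset.finite_toSet).trans ?_
  rw [Set.ncard_coe_finset]
  exact l.toFinset_card_le

lemma IsLocalRing.ringKrullDim_le_length {R : Type*} [CommRing R] [IsNoetherianRing R]
    [IsLocalRing R] {l : List R} (h : maximalIdeal R = Ideal.ofList l) :
    ringKrullDim R ≤ l.length := by
  refine (ringKrullDim_le_spanFinrank_maximalIdeal R).trans ?_
  rw [h]
  exact_mod_cast Ideal.spanFinrank_ofList_le l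

/-- Nakayama: the maximal ideal strictly contains its square unless it vanishes. -/
lemma IsLocalRing.maximalIdeal_eq_bot_of_le_sq {R : Type*} [CommRing R] [IsNoetherianRing R]
    [IsLocalRing R] (h : maximalIdeal R ≤ maximalIdeal R ^ 2) : maximalIdeal R = ⊥ := by
  refine Submodule.eq_bot_of_le_smul_of_le_jacobson_bot (maximalIdeal R) _
    (IsNoetherian.noetherian _) ?_ (jacobson_eq_maximalIdeal ⊥ bot_ne_top).ge
  rwa [smul_eq_mul, ← pow_two]

/-- Exchange: an element of `(l)` outside `m ^ 2` replaces one of the generators. -/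
lemma Ideal.exists_ofList_cons_eq {R : Type*} [CommRing R] [IsLocalRing R] {l : List R} {x : R}
    (hl : Ideal.ofList l ≤ maximalIdeal R) (hx : x ∈ Ideal.ofList l)
    (hx2 : x ∉ maximalIdeal R ^ 2) :
    ∃ l' : List R, l'.length + 1 = l.length ∧ Ideal.ofList (x :: l') = Ideal.ofList l := by
  induction l generalizing x with
  | nil => simp_all
  | cons f l ih =>
    rw [Ideal.ofList_cons] at hx hl
    obtain ⟨a, t, ht, rfl⟩ := Ideal.mem_span_singleton_sup.mp hx
    have hf : f ∈ maximalIdeal R := hl (Ideal.mem_sup_left (Ideal.mem_span_singleton_self f))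
    by_cases ha : IsUnit a
    · refine ⟨l, rfl, ?_⟩
      obtain ⟨b, hb⟩ := ha.exists_left_inv
      simp only [Ideal.ofList_cons]
      apply le_antisymm <;> refine sup_le ?_ le_sup_right <;>
        rw [Ideal.span_singleton_le_iff_mem, Ideal.mem_span_singleton_sup]
      · exact ⟨a, t, ht, rfl⟩
      · exact ⟨b, -(b * t), neg_mem (Ideal.mul_mem_left _ _ ht), by linear_combination f * hb⟩
    · have haf : a * f ∈ maximalIdeal R ^ 2 := by
        rw [pow_two]; exact Ideal.mul_mem_mul ((mem_maximalIdeal a).mpr ha) hf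
      obtain ⟨l', hlen, hl'⟩ := ih (le_sup_right.trans hl) ht
        (fun h ↦ hx2 (add_mem haf h))
      refine ⟨f :: l', by simp [← hlen], ?_⟩
      rw [Ideal.ofList_cons] at hl'
      rw [Ideal.ofList_cons, Ideal.ofList_cons, Ideal.ofList_cons, ← hl', ← sup_assoc, ← sup_assoc]
      congr 1
      have hmem : a * f ∈ Ideal.span {f} := Ideal.mul_mem_left _ _ (Ideal.mem_span_singleton_self f)
      apply le_antisymm
      · refine sup_le ?_ le_sup_left
        rw [Ideal.span_singleton_le_iff_mem]
        exact add_mem (Ideal.mem_sup_left hmem)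
          (Ideal.mem_sup_right (Ideal.mem_span_singleton_self t))
      · refine sup_le le_sup_right ?_
        rw [Ideal.span_singleton_le_iff_mem]
        simpa using sub_mem (Ideal.mem_sup_left (Ideal.mem_span_singleton_self (a * f + t)))
          (Ideal.mem_sup_right hmem)

lemma IsRegularSystem.perm {R : Type*} [CommRing R] [IsLocalRing R] {l l' : List R}
    (h : IsRegularSystem l) (hp : l.Perm l') : IsRegularSystem l' :=
  ⟨h.1.trans (Ideal.ofList_eq_of_perm hp), by rw [h.2, hp.length_eq]⟩

lemma IsRegularSystem.mem_maximalIdeal {R : Type*} [CommRing R] [IsLocalRing R] {x : R}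
    {l : List R} (h : IsRegularSystem (x :: l)) : x ∈ maximalIdeal R := by
  rw [h.1]
  exact Ideal.subset_span List.mem_cons_self

lemma IsRegularSystem.ne_zero {R : Type*} [CommRing R] [IsNoetherianRing R] [IsLocalRing R] {x : R}
    {l : List R} (h : IsRegularSystem (x :: l)) : x ≠ 0 := by
  rintro rfl
  have h1 : maximalIdeal R = Ideal.ofList l := by rw [h.1, Ideal.ofList_cons]; simp
  have h2 := ringKrullDim_le_length h1
  rw [h.2, List.length_cons] at h2
  have h3 : l.length + 1 ≤ l.length := by exact_mod_cast h2
  omega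

/-- Killing one parameter leaves a regular system of parameters of the quotient. -/
lemma IsRegularSystem.quotient {R : Type*} [CommRing R] [IsNoetherianRing R] [IsLocalRing R] {x : R}
    {l : List R} (h : IsRegularSystem (x :: l)) :
    ∃ _ : IsLocalRing (R ⧸ Ideal.span {x}),
      IsRegularSystem (l.map (Ideal.Quotient.mk (Ideal.span {x}))) := by
  have hx := h.mem_maximalIdeal
  have hne : Ideal.span {x} ≠ ⊤ := by
    rw [Ne, Ideal.span_singleton_eq_top]
    exact hx
  have : Nontrivial (R ⧸ Ideal.span {x}) := Ideal.Quotient.nontrivial_iff.mpr hne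
  have hloc : IsLocalRing (R ⧸ Ideal.span {x}) :=
    .of_surjective' (Ideal.Quotient.mk _) Ideal.Quotient.mk_surjective
  have hmax : maximalIdeal (R ⧸ Ideal.span {x}) =
      Ideal.ofList (l.map (Ideal.Quotient.mk (Ideal.span {x}))) := by
    rw [← map_maximalIdeal_of_surjective _ Ideal.Quotient.mk_surjective, h.1, Ideal.map_ofList,
      List.map_cons, Ideal.ofList_cons]
    simp [Ideal.Quotient.mk_singleton_self]
  refine ⟨hloc, hmax, le_antisymm (ringKrullDim_le_length hmax) ?_⟩
  have h1 := Ideal.height_le_ringKrullDim_quotient_add_one hx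
  rw [maximalIdeal_height_eq_ringKrullDim, h.2, List.length_cons] at h1
  rw [List.length_map]
  push_cast at h1
  exact ENat.WithBot.add_le_add_one_right_iff.mp h1

lemma IsRegularSystem.isDomain {R : Type*} [CommRing R] [IsNoetherianRing R] [IsLocalRing R]
    {l : List R} (h : IsRegularSystem l) : IsDomain R := by
  induction hn : l.length generalizing R with
  | zero =>
    obtain rfl := List.length_eq_zero_iff.mp hn
    have hm : maximalIdeal R = ⊥ := by rw [h.1, Ideal.ofList_nil]
    exact (isField_iff_maximalIdeal_eq.mpr hm).isDomain
  | succ n ih =>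
    obtain ⟨x, hxm, hx2, hxp⟩ : ∃ x ∈ maximalIdeal R, x ∉ maximalIdeal R ^ 2 ∧
        ∀ p ∈ minimalPrimes R, x ∉ p := by
      by_contra! hcon
      have hfin := minimalPrimes.finite_of_isNoetherianRing R
      classical
      have hsub : (maximalIdeal R : Set R) ⊆
          ⋃ i ∈ (↑(insert (maximalIdeal R ^ 2) hfin.toFinset) : Set (Ideal R)), (i : Set R) := by
        intro x hx
        by_cases hx2 : x ∈ maximalIdeal R ^ 2
        · exact Set.mem_biUnion (x := maximalIdeal R ^ 2) (by simp) hx2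
        · obtain ⟨p, hp, hxp⟩ := hcon x hx hx2
          exact Set.mem_biUnion (x := p) (by simp [hp]) hxp
      obtain ⟨i, hi, hle⟩ := (Ideal.subset_union_prime (f := id) (maximalIdeal R ^ 2)
        (maximalIdeal R ^ 2) (fun i hi h1 _ ↦ by
          simp only [Finset.mem_insert, h1, false_or, Set.Finite.mem_toFinset] at hi
          exact hi.1.1)).mp hsub
      have hmin : maximalIdeal R ∈ minimalPrimes R := by
        rcases Finset.mem_insert.mp hi with rfl | hi
        · have := maximalIdeal_eq_bot_of_le_sq hle
          have hb : (⊥ : Ideal R).IsPrime := this ▸ inferInstance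
          rw [this]
          exact ⟨⟨hb, le_rfl⟩, fun _ _ _ ↦ bot_le⟩
        · rw [Set.Finite.mem_toFinset] at hi
          have := hi.1.1
          have he : maximalIdeal R = i := le_antisymm hle (le_maximalIdeal this.ne_top)
          rwa [he]
      have h0 := maximalIdeal_height_eq_ringKrullDim (R := R)
      rw [Ideal.height_eq_zero_iff.mpr hmin, h.2, hn] at h0
      have : (0 : ℕ) = n + 1 := by exact_mod_cast h0
      omega
    obtain ⟨l', hlen, hl'⟩ := Ideal.exists_ofList_cons_eq h.1.ge (h.1 ▸ hxm) hx2
    have hsys : IsRegularSystem (x :: l') :=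
      ⟨h.1.trans hl'.symm, by rw [h.2, List.length_cons, hlen]⟩
    obtain ⟨_, hq⟩ := hsys.quotient
    have hdom := ih hq (by rw [List.length_map]; omega)
    have hprime : (Ideal.span {x}).IsPrime := (Ideal.Quotient.isDomain_iff_prime _).mp hdom
    obtain ⟨p, hp, hpx⟩ := Ideal.exists_minimalPrimes_le (bot_le (a := Ideal.span {x}))
    have hpp : p.IsPrime := hp.1.1
    have hpbot : p = ⊥ := by
      refine Submodule.eq_bot_of_le_smul_of_le_jacobson_bot (Ideal.span {x}) p
        (IsNoetherian.noetherian _) ?_ ?_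
      · intro y hy
        obtain ⟨z, rfl⟩ := Ideal.mem_span_singleton.mp (hpx hy)
        rw [smul_eq_mul, Ideal.mem_span_singleton_mul]
        exact ⟨z, (hpp.mem_or_mem hy).resolve_left (hxp p hp), rfl⟩
      · rw [jacobson_eq_maximalIdeal ⊥ bot_ne_top, Ideal.span_singleton_le_iff_mem]
        exact hxm
    rw [hpbot] at hpp
    exact (IsDomain.of_bot_isPrime R)

lemma Ideal.sup_pow_succ_le {R : Type*} [CommRing R] (I J : Ideal R) (r : ℕ) :
    (I ⊔ J) ^ (r + 1) ≤ I * (I ⊔ J) ^ r ⊔ J ^ (r + 1) := by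
  induction r with
  | zero => simp
  | succ r ih =>
    calc (I ⊔ J) ^ (r + 1 + 1) = I * (I ⊔ J) ^ (r + 1) ⊔ J * (I ⊔ J) ^ (r + 1) := by
          rw [← Ideal.sup_mul, ← pow_succ']
      _ ≤ I * (I ⊔ J) ^ (r + 1) ⊔ J * (I * (I ⊔ J) ^ r ⊔ J ^ (r + 1)) :=
          sup_le_sup_left (Ideal.mul_mono_right ih) _
      _ ≤ I * (I ⊔ J) ^ (r + 1) ⊔ J ^ (r + 1 + 1) := by
          rw [Ideal.mul_sup, ← pow_succ', mul_left_comm, ← sup_assoc]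
          refine sup_le_sup_right (sup_le le_rfl (Ideal.mul_mono_right ?_)) _
          rw [pow_succ']
          exact Ideal.mul_mono_left le_sup_right

/-- If `x` is regular modulo all powers of `J`, multiplication by `x` raises the order with respect
to `(x) + J` by at most one. -/
lemma Ideal.mem_sup_pow_of_mul_mem {R : Type*} [CommRing R] [IsDomain R] {J : Ideal R} {x : R}
    (hJ : ∀ (s : ℕ) (h : R), x * h ∈ J ^ s → h ∈ J ^ s) {r : ℕ} {h : R}
    (hh : x * h ∈ (Ideal.span {x} ⊔ J) ^ (r + 1)) : h ∈ (Ideal.span {x} ⊔ J) ^ r := by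
  obtain ⟨u, hu, j, hj, he⟩ := Submodule.mem_sup.mp (Ideal.sup_pow_succ_le _ _ _ hh)
  obtain ⟨z, hz, rfl⟩ := Ideal.mem_span_singleton_mul.mp hu
  have h1 : h - z ∈ J ^ (r + 1) := hJ _ _ (by
    have : x * (h - z) = j := by linear_combination -he
    rwa [this])
  have h2 : h - z ∈ (Ideal.span {x} ⊔ J) ^ r :=
    Ideal.pow_right_mono le_sup_right r (Ideal.pow_le_pow_right r.le_succ h1)
  simpa using add_mem h2 hz

lemma Ideal.exists_add_mul_of_mk_mem_map_pow {R : Type*} [CommRing R] {J : Ideal R} {y h : R}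
    {s : ℕ} (hh : Ideal.Quotient.mk (Ideal.span {y}) h ∈
      (J.map (Ideal.Quotient.mk (Ideal.span {y}))) ^ s) :
    ∃ e ∈ J ^ s, ∃ c, h = e + y * c := by
  rw [← Ideal.map_pow, Ideal.mem_map_iff_of_surjective _ Ideal.Quotient.mk_surjective] at hh
  obtain ⟨e, he, heq⟩ := hh
  obtain ⟨c, hc⟩ := Ideal.mem_span_singleton.mp (Ideal.Quotient.eq.mp heq.symm)
  exact ⟨e, he, c, by linear_combination hc⟩

/-- A parameter is regular modulo every power of an ideal generated by other parameters. -/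
lemma IsRegularSystem.mem_pow_of_mul_mem {R : Type*} [CommRing R] [IsNoetherianRing R]
    [IsLocalRing R] {x : R} {l l' : List R} (hsys : IsRegularSystem (x :: (l ++ l')))
    {s : ℕ} {h : R} (hh : x * h ∈ Ideal.ofList l ^ s) : h ∈ Ideal.ofList l ^ s := by
  induction hn : l.length generalizing R l' s with
  | zero =>
    obtain rfl := List.length_eq_zero_iff.mp hn
    have := hsys.isDomain
    cases s with
    | zero => simp
    | succ s =>
      have h0 : x * h = 0 := by
        simpa using Ideal.pow_le_self s.succ_ne_zero hh
      simp [(mul_eq_zero.mp h0).resolve_left hsys.ne_zero]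
  | succ n ih =>
    obtain ⟨y, l, rfl⟩ := List.exists_cons_of_length_eq_add_one hn
    simp only [List.length_cons, Nat.add_right_cancel_iff] at hn
    have := hsys.isDomain
    have hy : IsRegularSystem (y :: (l ++ (x :: l'))) := hsys.perm (by
      rw [List.cons_append]
      exact (List.Perm.swap _ _ _).trans (List.Perm.cons _ List.perm_middle.symm))
    have hcancel : ∀ (r : ℕ) (z : R), y * z ∈ Ideal.ofList (y :: l) ^ (r + 1) →
        z ∈ Ideal.ofList (y :: l) ^ r := by
      intro r z hz
      rw [Ideal.ofList_cons] at hz ⊢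
      exact Ideal.mem_sup_pow_of_mul_mem (fun s h hh ↦ ih hy hh hn) hz
    have hmap : (Ideal.ofList (y :: l)).map (Ideal.Quotient.mk (Ideal.span {y})) =
        Ideal.ofList (l.map (Ideal.Quotient.mk (Ideal.span {y}))) := by
      rw [Ideal.map_ofList, List.map_cons, Ideal.ofList_cons]
      simp [Ideal.Quotient.mk_singleton_self]
    obtain ⟨_, hq⟩ := (hsys.perm (l' := y :: x :: (l ++ l')) (List.Perm.swap _ _ _)).quotient
    rw [List.map_cons, List.map_append] at hq
    induction s generalizing h with
    | zero => simp
    | succ s ihs =>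
      have h1 : Ideal.Quotient.mk (Ideal.span {y}) h ∈
          Ideal.ofList (l.map (Ideal.Quotient.mk (Ideal.span {y}))) ^ (s + 1) := by
        refine ih hq ?_ (by simpa using hn)
        rw [← map_mul, ← hmap, ← Ideal.map_pow]
        exact Ideal.mem_map_of_mem _ hh
      rw [← hmap] at h1
      obtain ⟨e, he, c, rfl⟩ := Ideal.exists_add_mul_of_mk_mem_map_pow h1
      have h2 : y * (x * c) ∈ Ideal.ofList (y :: l) ^ (s + 1) := by
        have := sub_mem hh (Ideal.mul_mem_left _ x he)
        rwa [show x * (e + y * c) - x * e = y * (x * c) by ring] at this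
      have h3 := ihs (hcancel _ _ h2)
      refine add_mem he ?_
      rw [pow_succ']
      exact Ideal.mul_mem_mul (Ideal.subset_span List.mem_cons_self) h3

/-- The associated graded ring of a regular local ring has no zero divisors. -/
lemma IsRegularSystem.mem_pow_or_mem_pow {R : Type*} [CommRing R] [IsNoetherianRing R]
    [IsLocalRing R] {l : List R} (hsys : IsRegularSystem l) {r s : ℕ} {a b : R}
    (ha : a ∈ maximalIdeal R ^ r) (hb : b ∈ maximalIdeal R ^ s)
    (hab : a * b ∈ maximalIdeal R ^ (r + s + 1)) :
    a ∈ maximalIdeal R ^ (r + 1) ∨ b ∈ maximalIdeal R ^ (s + 1) := by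
  induction hn : l.length generalizing R r s with
  | zero =>
    obtain rfl := List.length_eq_zero_iff.mp hn
    have := hsys.isDomain
    have hm : maximalIdeal R = ⊥ := by rw [hsys.1, Ideal.ofList_nil]
    have h0 : a * b = 0 := by
      simpa [hm] using Ideal.pow_le_self (r + s).succ_ne_zero hab
    rcases mul_eq_zero.mp h0 with rfl | rfl <;> simp
  | succ n ih =>
    obtain ⟨x, l, rfl⟩ := List.exists_cons_of_length_eq_add_one hn
    simp only [List.length_cons, Nat.add_right_cancel_iff] at hn
    have := hsys.isDomain
    have hxm := hsys.mem_maximalIdeal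
    have hcancel : ∀ {r : ℕ} {z : R}, x * z ∈ maximalIdeal R ^ (r + 1) →
        z ∈ maximalIdeal R ^ r := by
      intro r z hz
      rw [hsys.1, Ideal.ofList_cons] at hz ⊢
      exact Ideal.mem_sup_pow_of_mul_mem (fun s h hh ↦
        IsRegularSystem.mem_pow_of_mul_mem (l' := []) (by simpa using hsys) hh) hz
    obtain ⟨_, hq⟩ := hsys.quotient
    have hmap := map_maximalIdeal_of_surjective (Ideal.Quotient.mk (Ideal.span {x}))
      Ideal.Quotient.mk_surjective
    have hmk : ∀ {t : ℕ} {c : R}, c ∈ maximalIdeal R ^ t → Ideal.Quotient.mk (Ideal.span {x}) c ∈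
        maximalIdeal (R ⧸ Ideal.span {x}) ^ t := by
      intro t c hc
      rw [← hmap, ← Ideal.map_pow]
      exact Ideal.mem_map_of_mem _ hc
    -- A factor of order `t` whose image has larger order is, modulo higher order, `x * c`.
    have hlift : ∀ {t : ℕ} {c : R}, c ∈ maximalIdeal R ^ t → Ideal.Quotient.mk (Ideal.span {x}) c ∈
        maximalIdeal (R ⧸ Ideal.span {x}) ^ (t + 1) → ∃ e ∈ maximalIdeal R ^ (t + 1), ∃ d,
          c = e + x * d ∧ x * d ∈ maximalIdeal R ^ t := by
      intro t c hc hc'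
      rw [← hmap] at hc'
      obtain ⟨e, he, d, rfl⟩ := Ideal.exists_add_mul_of_mk_mem_map_pow hc'
      refine ⟨e, he, d, rfl, ?_⟩
      simpa using sub_mem hc (Ideal.pow_le_pow_right t.le_succ he)
    induction hk : r + s using Nat.strong_induction_on generalizing r s a b with
    | _ k ihk =>
    subst hk
    have key : ∀ {r' s' : ℕ} {a b : R}, r' + s' = r + s → a ∈ maximalIdeal R ^ r' →
        b ∈ maximalIdeal R ^ s' → a * b ∈ maximalIdeal R ^ (r' + s' + 1) →
        Ideal.Quotient.mk (Ideal.span {x}) a ∈ maximalIdeal (R ⧸ Ideal.span {x}) ^ (r' + 1) →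
        a ∈ maximalIdeal R ^ (r' + 1) ∨ b ∈ maximalIdeal R ^ (s' + 1) := by
      intro r' s' a b hrs ha hb hab hma
      obtain ⟨e, he, d, rfl, hd⟩ := hlift ha hma
      cases r' with
      | zero =>
        left
        exact add_mem he (by simpa using Ideal.mul_mem_right d _ hxm)
      | succ t =>
        have heb : e * b ∈ maximalIdeal R ^ (t + 1 + s' + 1) := by
          rw [show t + 1 + s' + 1 = t + 1 + 1 + s' by ring, pow_add]
          exact Ideal.mul_mem_mul he hb
        have hdb : x * (d * b) ∈ maximalIdeal R ^ (t + s' + 1 + 1) := by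
          have := sub_mem hab heb
          rwa [show (e + x * d) * b - e * b = x * (d * b) by ring,
            show t + 1 + s' + 1 = t + s' + 1 + 1 by ring] at this
        refine (ihk (t + s') (by omega) (hcancel hd) hb (hcancel hdb) rfl).imp_left fun h ↦ ?_
        refine add_mem he ?_
        rw [pow_succ']
        exact Ideal.mul_mem_mul hxm h
    have hmab : Ideal.Quotient.mk (Ideal.span {x}) a * Ideal.Quotient.mk (Ideal.span {x}) b ∈
        maximalIdeal (R ⧸ Ideal.span {x}) ^ (r + s + 1) := by
      rw [← map_mul]
      exact hmk hab
    rcases ih hq (hmk ha) (hmk hb) hmab (by simpa using hn) with h | h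
    · exact key rfl ha hb hab h
    · refine (key (add_comm s r) hb ha ?_ h).symm
      rwa [mul_comm, add_comm s r]

section ordFun

variable {R : Type*} [CommRing R] [IsNoetherianRing R] [IsLocalRing R]

lemma bddAbove_setOf_mem_maximalIdeal_pow {g : R} (hg : g ≠ 0) :
    BddAbove {r : ℕ | g ∈ maximalIdeal R ^ r} := by
  obtain ⟨n, hn⟩ : ∃ n, g ∉ maximalIdeal R ^ n := by
    by_contra! h
    have := Ideal.iInf_pow_eq_bot_of_isLocalRing (maximalIdeal R) Ideal.IsPrime.ne_top'
    exact hg (by rwa [← Ideal.mem_bot, ← this, Ideal.mem_iInf])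
  refine ⟨n, fun r hr ↦ ?_⟩
  by_contra! h
  exact hn (Ideal.pow_le_pow_right h.le hr)

lemma le_ordFun_iff {g : R} (hg : g ≠ 0) {k : ℕ} :
    k ≤ ordFun R g ↔ g ∈ maximalIdeal R ^ k := by
  have hb := bddAbove_setOf_mem_maximalIdeal_pow hg
  have hmem : g ∈ maximalIdeal R ^ ordFun R g := Nat.sSup_mem ⟨0, by simp⟩ hb
  exact ⟨fun h ↦ Ideal.pow_le_pow_right h hmem, fun h ↦ le_csSup hb h⟩

lemma ordFun_eq_iff {g : R} (hg : g ≠ 0) {k : ℕ} :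
    ordFun R g = k ↔ g ∈ maximalIdeal R ^ k ∧ g ∉ maximalIdeal R ^ (k + 1) := by
  rw [← le_ordFun_iff hg, ← le_ordFun_iff hg]
  omega

lemma min_ordFun_le_ordFun_add {a b : R} (ha : a ≠ 0) (hb : b ≠ 0) (hab : a + b ≠ 0) :
    min (ordFun R a) (ordFun R b) ≤ ordFun R (a + b) :=
  (le_ordFun_iff hab).mpr (add_mem ((le_ordFun_iff ha).mp (min_le_left _ _))
    ((le_ordFun_iff hb).mp (min_le_right _ _)))

lemma IsRegularSystem.ordFun_mul {l : List R} (hsys : IsRegularSystem l) {a b : R} (ha : a ≠ 0)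
    (hb : b ≠ 0) : ordFun R (a * b) = ordFun R a + ordFun R b := by
  have := hsys.isDomain
  obtain ⟨ha1, ha2⟩ := (ordFun_eq_iff ha).mp rfl
  obtain ⟨hb1, hb2⟩ := (ordFun_eq_iff hb).mp rfl
  refine (ordFun_eq_iff (mul_ne_zero ha hb)).mpr ⟨?_, fun h ↦ ?_⟩
  · rw [pow_add]
    exact Ideal.mul_mem_mul ha1 hb1
  · exact (hsys.mem_pow_or_mem_pow ha1 hb1 h).elim ha2 hb2

end ordFun

/-- The extension of the order function to the fraction field: `a / b ↦ v a - v b`. -/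
noncomputable def fractionOrd (R : Type*) [CommRing R] [IsDomain R] [IsLocalRing R]
    (x : FractionRing R) : ℤ :=
  ordFun R (IsLocalization.sec (nonZeroDivisors R) x).1 -
    ordFun R ((IsLocalization.sec (nonZeroDivisors R) x).2 : R)

lemma fractionOrd_div {R : Type*} [CommRing R] [IsDomain R] [IsLocalRing R]
    (hmul : ∀ g g' : R, g ≠ 0 → g' ≠ 0 → ordFun R (g * g') = ordFun R g + ordFun R g')
    {a b : R} (ha : a ≠ 0) (hb : b ≠ 0) :
    fractionOrd R (algebraMap R (FractionRing R) a / algebraMap R (FractionRing R) b) =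
      ordFun R a - ordFun R b := by
  have hinj := IsFractionRing.injective R (FractionRing R)
  have hb' : algebraMap R (FractionRing R) b ≠ 0 := by simpa using hb
  set x := algebraMap R (FractionRing R) a / algebraMap R (FractionRing R) b with hx
  have hspec := IsLocalization.sec_spec (nonZeroDivisors R) x
  rw [fractionOrd]
  generalize IsLocalization.sec (nonZeroDivisors R) x = q at hspec ⊢
  obtain ⟨c, d, hd⟩ := q
  replace hd : d ≠ 0 := nonZeroDivisors.ne_zero hd
  dsimp only at hspec ⊢
  have heq : a * d = c * b := hinj (by
    rw [map_mul, map_mul, ← hspec, hx]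
    field_simp)
  have hc : c ≠ 0 := by
    intro h
    rw [h, zero_mul] at heq
    exact mul_ne_zero ha hd heq
  have h1 := hmul a d ha hd
  rw [heq, hmul c b hc hb] at h1
  omega

/-- Let `R` be a Noetherian regular local ring (regular: the maximal ideal is generated by
`n` elements where `n = ringKrullDim R`) with nonzero maximal ideal `I`.  Then
`v g = max {r | g ∈ I^r}` satisfies `v (g*g') = v g + v g'` for nonzero `g, g'`, and
extends to a discrete valuation on the fraction field of `R`. -/
theorem ordFun_extends_to_discrete_valuation (R : Type*) [CommRing R] [IsDomain R]
    [IsNoetherianRing R] [IsLocalRing R]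
    (hreg : ∃ (n : ℕ) (f : Fin n → R),
      IsLocalRing.maximalIdeal R = Ideal.span (Set.range f) ∧ ringKrullDim R = n)
    (hI : IsLocalRing.maximalIdeal R ≠ 0) :
    (∀ g g' : R, g ≠ 0 → g' ≠ 0 → ordFun R (g * g') = ordFun R g + ordFun R g') ∧
    ∃ w : FractionRing R → ℤ,
      (∀ x y : FractionRing R, x ≠ 0 → y ≠ 0 → w (x * y) = w x + w y) ∧
      (∀ x y : FractionRing R, x ≠ 0 → y ≠ 0 → x + y ≠ 0 →
        min (w x) (w y) ≤ w (x + y)) ∧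
      (∀ k : ℤ, ∃ x : FractionRing R, x ≠ 0 ∧ w x = k) ∧
      (∀ g : R, g ≠ 0 → w (algebraMap R (FractionRing R) g) = ordFun R g) := by
  obtain ⟨n, f, hf, hdim⟩ := hreg
  have hsys : IsRegularSystem (List.ofFn f) :=
    ⟨by rw [hf, Ideal.ofList]; congr 1; ext; simp [List.mem_ofFn], by simpa using hdim⟩
  have hmul : ∀ g g' : R, g ≠ 0 → g' ≠ 0 → ordFun R (g * g') = ordFun R g + ordFun R g' :=
    fun g g' hg hg' ↦ hsys.ordFun_mul hg hg'
  have hone : ordFun R (1 : R) = 0 := by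
    have := hmul 1 1 one_ne_zero one_ne_zero
    rw [mul_one] at this
    omega
  have hrep : ∀ x : FractionRing R, x ≠ 0 → ∃ a b : R, a ≠ 0 ∧ b ≠ 0 ∧
      x = algebraMap R (FractionRing R) a / algebraMap R (FractionRing R) b := by
    intro x hx
    obtain ⟨a, b, hb, rfl⟩ := IsFractionRing.div_surjective (A := R) x
    refine ⟨a, b, ?_, nonZeroDivisors.ne_zero hb, rfl⟩
    rintro rfl
    simp at hx
  refine ⟨hmul, fractionOrd R, ?_, ?_, ?_, ?_⟩
  · intro x y hx hy
    obtain ⟨a, b, ha, hb, rfl⟩ := hrep x hx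
    obtain ⟨c, d, hc, hd, rfl⟩ := hrep y hy
    rw [div_mul_div_comm, ← map_mul, ← map_mul, fractionOrd_div hmul ha hb,
      fractionOrd_div hmul hc hd, fractionOrd_div hmul (mul_ne_zero ha hc) (mul_ne_zero hb hd),
      hmul a c ha hc, hmul b d hb hd]
    push_cast
    ring
  · intro x y hx hy hxy
    obtain ⟨a, b, ha, hb, rfl⟩ := hrep x hx
    obtain ⟨c, d, hc, hd, rfl⟩ := hrep y hy
    have hb' : algebraMap R (FractionRing R) b ≠ 0 := by simpa using hb
    have hd' : algebraMap R (FractionRing R) d ≠ 0 := by simpa using hd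
    rw [div_add_div _ _ hb' hd', ← map_mul, ← map_mul, ← map_mul, ← map_add] at hxy ⊢
    have hs : a * d + b * c ≠ 0 := by
      intro h
      simp [h] at hxy
    rw [fractionOrd_div hmul ha hb, fractionOrd_div hmul hc hd,
      fractionOrd_div hmul hs (mul_ne_zero hb hd)]
    have h1 := min_ordFun_le_ordFun_add (mul_ne_zero ha hd) (mul_ne_zero hb hc) hs
    rw [hmul a d ha hd, hmul b c hb hc] at h1
    rw [hmul b d hb hd]
    omega
  · obtain ⟨p, hp, hp2⟩ : ∃ p ∈ maximalIdeal R, p ∉ maximalIdeal R ^ 2 := by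
      by_contra! h
      exact hI (maximalIdeal_eq_bot_of_le_sq h)
    have hp0 : p ≠ 0 := by
      rintro rfl
      simp at hp2
    have hp1 : ordFun R p = 1 := (ordFun_eq_iff hp0).mpr ⟨by simpa using hp, hp2⟩
    have hpow : ∀ k : ℕ, ordFun R (p ^ k) = k := by
      intro k
      induction k with
      | zero => simpa using hone
      | succ k ih => rw [pow_succ, hmul _ _ (pow_ne_zero k hp0) hp0, ih, hp1]
    intro k
    refine ⟨algebraMap R (FractionRing R) (p ^ k.toNat) /
      algebraMap R (FractionRing R) (p ^ (-k).toNat), ?_, ?_⟩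
    · simp [hp0]
    · rw [fractionOrd_div hmul (pow_ne_zero _ hp0) (pow_ne_zero _ hp0), hpow, hpow]
      omega
  · intro g hg
    have := fractionOrd_div hmul hg one_ne_zero
    simpa [hone] using this
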